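/- If u ∈ A_1 ∩ Ker(τ), then there exists a B-derivation δ of A = R/fR such that δ(x) = u. -/

import Mathlib

/-- The additive map sending the coefficients `c` to the skew polynomial `Σ X^i c_i`. -/
noncomputable def skewEval {B R : Type*} [Ring B] [Ring R] (ι : B →+* R) (X : R) :
    (ℕ →₀ B) →+ R :=
  Finsupp.liftAddHom fun i => (AddMonoidHom.mulLeft (X ^ i)).comp ι.toAddMonoidHom

/-- The additive subgroup of skew polynomials of degree less than `n`. -/
def skewDegreeLT {B R : Type*} [Ring B] [Ring R] (ι : B →+* R) (X : R) (n : ℕ) :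
    AddSubgroup R :=
  AddSubgroup.closure {r | ∃ i < n, ∃ b : B, r = X ^ i * ι b}

section SkewPolynomial

variable {B R : Type*} [Ring B] [Ring R] {ι : B →+* R} {X : R}

theorem skewEval_apply (c : ℕ →₀ B) :
    skewEval ι X c = c.sum fun i b => X ^ i * ι b := by
  rfl

theorem skewEval_single (i : ℕ) (b : B) :
    skewEval ι X (Finsupp.single i b) = X ^ i * ι b := by
  simp [skewEval]

theorem skewEval_bijective
    (hfree : ∀ r : R, ∃! c : ℕ →₀ B, r = c.sum fun i b => X ^ i * ι b) :
    Function.Bijective (skewEval ι X) := by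
  rw [Function.bijective_iff_existsUnique]
  intro r
  simpa only [skewEval_apply, eq_comm] using hfree r

theorem skew_induction
    (hfree : ∀ r : R, ∃! c : ℕ →₀ B, r = c.sum fun i b => X ^ i * ι b)
    {p : R → Prop} (zero : p 0) (add : ∀ r s, p r → p s → p (r + s))
    (monomial : ∀ i b, p (X ^ i * ι b)) (r : R) : p r := by
  obtain ⟨c, rfl⟩ := (skewEval_bijective hfree).2 r
  induction c using Finsupp.induction_linear with
  | zero => simpa using zero
  | add c d hc hd => simpa using add _ _ hc hd
  | single i b => simpa only [skewEval_single] using monomial i b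

theorem monomial_mem_skewDegreeLT {i n : ℕ} (h : i < n) (b : B) :
    X ^ i * ι b ∈ skewDegreeLT ι X n :=
  AddSubgroup.subset_closure ⟨i, h, b, rfl⟩

theorem skewDegreeLT_mono {k n : ℕ} (h : k ≤ n) :
    skewDegreeLT ι X k ≤ skewDegreeLT ι X n :=
  AddSubgroup.closure_mono fun _ ⟨i, hi, b, hb⟩ => ⟨i, hi.trans_le h, b, hb⟩

theorem mul_coeff_mem_skewDegreeLT {n : ℕ} {r : R} (hr : r ∈ skewDegreeLT ι X n) (b : B) :
    r * ι b ∈ skewDegreeLT ι X n := by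
  induction hr using AddSubgroup.closure_induction with
  | mem r h =>
    obtain ⟨i, hi, c, rfl⟩ := h
    rw [mul_assoc, ← map_mul]
    exact monomial_mem_skewDegreeLT hi _
  | zero => simp
  | add r s _ _ hr hs => rw [add_mul]; exact add_mem hr hs
  | neg r _ hr => rw [neg_mul]; exact neg_mem hr

theorem monomial_mul_X {ρ D : B → B}
    (hcomm : ∀ α : B, ι α * X = X * ι (ρ α) + ι (D α)) (i : ℕ) (b : B) :
    X ^ i * ι b * X = X ^ (i + 1) * ι (ρ b) + X ^ i * ι (D b) := by
  rw [mul_assoc, hcomm, mul_add, pow_succ, mul_assoc]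

theorem mul_X_pow_mem_skewDegreeLT {ρ D : B → B}
    (hcomm : ∀ α : B, ι α * X = X * ι (ρ α) + ι (D α)) {n : ℕ} {r : R}
    (hr : r ∈ skewDegreeLT ι X n) (k : ℕ) : r * X ^ k ∈ skewDegreeLT ι X (n + k) := by
  induction k with
  | zero => simpa using hr
  | succ k ih =>
    rw [pow_succ, ← mul_assoc, ← add_assoc]
    generalize r * X ^ k = s at ih
    induction ih using AddSubgroup.closure_induction with
    | mem s h =>
      obtain ⟨i, hi, c, rfl⟩ := h
      rw [monomial_mul_X hcomm]
      exact add_mem (monomial_mem_skewDegreeLT (by lia) _)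
        (monomial_mem_skewDegreeLT (by lia) _)
    | zero => simp
    | add r s _ _ hr hs => rw [add_mul]; exact add_mem hr hs
    | neg r _ hr => rw [neg_mul]; exact neg_mem hr

theorem mul_mem_skewDegreeLT {ρ D : B → B}
    (hcomm : ∀ α : B, ι α * X = X * ι (ρ α) + ι (D α)) {n k : ℕ} {r s : R}
    (hr : r ∈ skewDegreeLT ι X (n + 1)) (hs : s ∈ skewDegreeLT ι X k) :
    r * s ∈ skewDegreeLT ι X (n + k) := by
  induction hs using AddSubgroup.closure_induction with
  | mem s h =>
    obtain ⟨i, hi, c, rfl⟩ := h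
    rw [← mul_assoc]
    exact mul_coeff_mem_skewDegreeLT
      (skewDegreeLT_mono (by lia) (mul_X_pow_mem_skewDegreeLT hcomm hr i)) c
  | zero => simp
  | add r s _ _ hr hs => rw [mul_add]; exact add_mem hr hs
  | neg r _ hr => rw [mul_neg]; exact neg_mem hr

theorem exists_leadingTerm_of_mem_skewDegreeLT {n : ℕ} {r : R}
    (hr : r ∈ skewDegreeLT ι X (n + 1)) :
    ∃ b : B, ∃ s ∈ skewDegreeLT ι X n, r = X ^ n * ι b + s := by
  induction hr using AddSubgroup.closure_induction with
  | mem r h =>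
    obtain ⟨i, hi, c, rfl⟩ := h
    rcases Nat.lt_succ_iff_lt_or_eq.1 hi with hi | rfl
    · exact ⟨0, _, monomial_mem_skewDegreeLT hi c, by simp⟩
    · exact ⟨c, 0, zero_mem _, by simp⟩
  | zero => exact ⟨0, 0, zero_mem _, by simp⟩
  | add r s _ _ hr hs =>
    obtain ⟨b, t, ht, rfl⟩ := hr
    obtain ⟨c, v, hv, rfl⟩ := hs
    exact ⟨b + c, t + v, add_mem ht hv, by rw [map_add, mul_add]; abel⟩
  | neg r _ hr =>
    obtain ⟨b, t, ht, rfl⟩ := hr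
    exact ⟨-b, -t, neg_mem ht, by rw [map_neg, mul_neg]; abel⟩

theorem exists_mem_skewDegreeLT
    (hfree : ∀ r : R, ∃! c : ℕ →₀ B, r = c.sum fun i b => X ^ i * ι b) (r : R) :
    ∃ n, r ∈ skewDegreeLT ι X n := by
  induction r using skew_induction hfree with
  | zero => exact ⟨0, zero_mem _⟩
  | add r s hr hs =>
    obtain ⟨n, hn⟩ := hr
    obtain ⟨k, hk⟩ := hs
    exact ⟨max n k, add_mem (skewDegreeLT_mono (le_max_left _ _) hn)
      (skewDegreeLT_mono (le_max_right _ _) hk)⟩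
  | monomial i b => exact ⟨i + 1, monomial_mem_skewDegreeLT i.lt_succ_self b⟩

theorem eq_zero_of_monomial_mem_skewDegreeLT
    (hfree : ∀ r : R, ∃! c : ℕ →₀ B, r = c.sum fun i b => X ^ i * ι b) {n : ℕ} {b : B}
    (h : X ^ n * ι b ∈ skewDegreeLT ι X n) : b = 0 := by
  let e := AddEquiv.ofBijective (skewEval ι X) (skewEval_bijective hfree)
  have he : ∀ i (c : B), e.symm (X ^ i * ι c) = Finsupp.single i c := fun i c => by
    rw [AddEquiv.symm_apply_eq]
    exact (skewEval_single i c).symm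
  have hle : skewDegreeLT ι X n ≤
      ((Finsupp.applyAddHom n).comp e.symm.toAddMonoidHom).ker := by
    refine (AddSubgroup.closure_le _).2 ?_
    rintro _ ⟨i, hi, c, rfl⟩
    change e.symm (X ^ i * ι c) n = 0
    rw [he, Finsupp.single_eq_of_ne hi.ne']
  have hcoeff : e.symm (X ^ n * ι b) n = 0 := hle h
  rwa [he, Finsupp.single_eq_same] at hcoeff

/-- A right multiple of a monic skew polynomial of degree `m` which has degree less than `m`
is a multiple by zero. -/
theorem eq_zero_of_monic_mul_mem_skewDegreeLT {ρ D : B → B}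
    (hcomm : ∀ α : B, ι α * X = X * ι (ρ α) + ι (D α))
    (hfree : ∀ r : R, ∃! c : ℕ →₀ B, r = c.sum fun i b => X ^ i * ι b)
    {m : ℕ} {g t : R} (hg : g ∈ skewDegreeLT ι X m)
    (h : (X ^ m + g) * t ∈ skewDegreeLT ι X m) : t = 0 := by
  have hf : X ^ m + g ∈ skewDegreeLT ι X (m + 1) :=
    add_mem (by simpa using monomial_mem_skewDegreeLT (ι := ι) (X := X) m.lt_succ_self 1)
      (skewDegreeLT_mono m.le_succ hg)
  obtain ⟨n, hn⟩ := exists_mem_skewDegreeLT hfree t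
  induction n generalizing t with
  | zero => simpa [skewDegreeLT] using hn
  | succ n ih =>
    obtain ⟨b, s, hs, rfl⟩ := exists_leadingTerm_of_mem_skewDegreeLT hn
    have hb : b = 0 := by
      apply eq_zero_of_monomial_mem_skewDegreeLT hfree (n := m + n)
      have : X ^ (m + n) * ι b =
          (X ^ m + g) * (X ^ n * ι b + s) - (X ^ m + g) * s - g * X ^ n * ι b := by
        rw [pow_add]; noncomm_ring
      rw [this]
      exact sub_mem (sub_mem (skewDegreeLT_mono (by lia) h) (mul_mem_skewDegreeLT hcomm hf hs))
        (mul_coeff_mem_skewDegreeLT (mul_X_pow_mem_skewDegreeLT hcomm hg n) b)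
    subst hb
    simp only [map_zero, mul_zero, zero_add] at h ⊢
    exact ih h hs

/-- If `Xf ∈ fR` for a monic `f` with `ρ`-invariant coefficients, then `D` kills the
coefficients of `f`. -/
theorem derivation_coeff_eq_zero {ρ : B → B} {D : B →+ B} (hD1 : D 1 = 0)
    (hcomm : ∀ α : B, ι α * X = X * ι (ρ α) + ι (D α))
    (hfree : ∀ r : R, ∃! c : ℕ →₀ B, r = c.sum fun i b => X ^ i * ι b)
    {m : ℕ} {a : ℕ → B} (ham : a m = 1) (hρa : ∀ i ≤ m, ρ (a i) = a i)
    {f : R} (hf : f = ∑ i ∈ Finset.range (m + 1), X ^ i * ι (a i))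
    (hX : ∃ s, X * f = f * s) {i : ℕ} (hi : i ≤ m) : D (a i) = 0 := by
  obtain ⟨s, hs⟩ := hX
  have hfX : f * X = X * f + ∑ i ∈ Finset.range m, X ^ i * ι (D (a i)) := by
    have : f * X = X * f + ∑ i ∈ Finset.range (m + 1), X ^ i * ι (D (a i)) := by
      rw [hf, Finset.sum_mul, Finset.mul_sum, ← Finset.sum_add_distrib]
      refine Finset.sum_congr rfl fun i hi => ?_
      rw [monomial_mul_X hcomm, hρa i (Finset.mem_range_succ_iff.1 hi), pow_succ', mul_assoc]
    rw [this, Finset.sum_range_succ, ham, hD1, map_zero, mul_zero, add_zero]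
  have hsum : f * (X - s) = ∑ i ∈ Finset.range m, X ^ i * ι (D (a i)) := by
    rw [mul_sub, hfX, hs, add_sub_cancel_left]
  have hsplit : f = X ^ m + ∑ i ∈ Finset.range m, X ^ i * ι (a i) := by
    rw [hf, Finset.sum_range_succ, ham, map_one, mul_one, add_comm]
  have hmem : ∀ b : ℕ → B, ∑ i ∈ Finset.range m, X ^ i * ι (b i) ∈ skewDegreeLT ι X m :=
    fun b => sum_mem fun i hi => monomial_mem_skewDegreeLT (Finset.mem_range.1 hi) _
  have hXs : X - s = 0 := by
    refine eq_zero_of_monic_mul_mem_skewDegreeLT hcomm hfree (hmem a) ?_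
    rw [← hsplit, hsum]
    exact hmem fun i => D (a i)
  rw [hXs, mul_zero] at hsum
  rcases hi.lt_or_eq with hi | rfl
  · have hzero : ∑ i ∈ Finset.range m, Finsupp.single i (D (a i)) = 0 := by
      apply (skewEval_bijective hfree).1
      rw [map_sum, map_zero, hsum]
      exact Finset.sum_congr rfl fun i _ => skewEval_single i _
    have := DFunLike.congr_fun hzero i
    simpa [Finsupp.finsetSum_apply, Finsupp.single_apply, hi] using this
  · rw [ham, hD1]

/-- For a ring homomorphism `π : R → A` and `u ∈ A` with `α u = u ρ(α)` for all `α ∈ B`, there is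
a `π`-derivation of the skew polynomial ring `R` into `A` vanishing on `B` and sending `X` to
`u`, given on powers of `X` by the Leibniz formula. -/
theorem exists_skew_derivation {A : Type*} [Ring A] {ρ D : B → B}
    (hcomm : ∀ α : B, ι α * X = X * ι (ρ α) + ι (D α))
    (hfree : ∀ r : R, ∃! c : ℕ →₀ B, r = c.sum fun i b => X ^ i * ι b)
    (π : R →+* A) (u : A) (hu : ∀ α : B, π (ι α) * u = u * π (ι (ρ α))) :
    ∃ Δ : R →+ A, (∀ r s, Δ (r * s) = Δ r * π s + π r * Δ s) ∧
      ∀ i b, Δ (X ^ i * ι b) =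
        (∑ j ∈ Finset.range i, π X ^ (i - 1 - j) * u * π X ^ j) * π (ι b) := by
  let L : ℕ → A := fun i => ∑ j ∈ Finset.range i, π X ^ (i - 1 - j) * u * π X ^ j
  have hL : ∀ i, L (i + 1) = L i * π X + π X ^ i * u := fun i => by
    simp only [L, Finset.sum_range_succ', Finset.sum_mul]
    congr 1
    · refine Finset.sum_congr rfl fun j _ => ?_
      rw [pow_succ (π X) j, ← mul_assoc]
      congr 4
      lia
    · simp
  let e := AddEquiv.ofBijective (skewEval ι X) (skewEval_bijective hfree)
  let Δ : R →+ A := (Finsupp.liftAddHom fun i => (AddMonoidHom.mulLeft (L i)).comp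
    (π.comp ι).toAddMonoidHom).comp e.symm.toAddMonoidHom
  have hΔ : ∀ i b, Δ (X ^ i * ι b) = L i * π (ι b) := fun i b => by
    have : e.symm (X ^ i * ι b) = Finsupp.single i b := by
      rw [AddEquiv.symm_apply_eq]
      exact (skewEval_single i b).symm
    simp [Δ, this]
  have hcoeff : ∀ r b, Δ (r * ι b) = Δ r * π (ι b) := fun r b => by
    induction r using skew_induction hfree with
    | zero => simp
    | add r s hr hs => rw [add_mul, map_add, hr, hs, map_add, add_mul]
    | monomial i c => rw [mul_assoc, ← map_mul, hΔ, hΔ, map_mul, map_mul, mul_assoc]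
  have hX : ∀ r, Δ (r * X) = Δ r * π X + π r * u := fun r => by
    induction r using skew_induction hfree with
    | zero => simp
    | add r s hr hs => simp only [add_mul, map_add, hr, hs]; abel
    | monomial i c =>
      have hc : π (ι c) * π X = π X * π (ι (ρ c)) + π (ι (D c)) := by
        rw [← map_mul, hcomm, map_add, map_mul]
      rw [monomial_mul_X hcomm, map_add, hΔ, hΔ, hΔ, hL, map_mul, map_pow, mul_assoc, hc,
        mul_assoc, hu]
      noncomm_ring
  have hone : Δ 1 = 0 := by simpa [L] using hΔ 0 1
  have hpow : ∀ n r, Δ (r * X ^ n) = Δ r * π (X ^ n) + π r * Δ (X ^ n) := fun n => by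
    induction n with
    | zero => simp [hone]
    | succ n ih =>
      intro r
      rw [pow_succ, ← mul_assoc, hX, hX, ih, map_mul, map_mul]
      noncomm_ring
  refine ⟨Δ, fun r s => ?_, hΔ⟩
  induction s using skew_induction hfree with
  | zero => simp
  | add s t hs ht => simp only [mul_add, map_add, hs, ht]; abel
  | monomial i c =>
    rw [← mul_assoc, hcoeff, hcoeff, hpow, map_mul]
    noncomm_ring

end SkewPolynomial

/-- In the setting of a monic `f = Σ_{i=0}^{m} X^i a_i` of degree `m ≥ 1` in `R = B[X;ρ,D]`
with all `a_i ∈ B^ρ` and `fR = Rf`, with `A = R/fR`, `x = X + fR`,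
`y_j = Σ_{k=j}^{m−1} x^{k−j} a_{k+1}` and `τ(z) = Σ_{j=0}^{m−1} y_j z x^j`:
if `u ∈ A_1 ∩ Ker(τ)`, then there exists a `B`-derivation `δ` of `A` with `δ(x) = u`. -/
theorem stmt11 {B R A : Type*} [Ring B] [Ring R] [Ring A]
    (ι : B →+* R) (hι : Function.Injective ι) (X : R)
    (ρ : B ≃+* B) (D : B →+ B)
    (hD : ∀ α β : B, D (α * β) = D α * ρ β + α * D β)
    (hcomm : ∀ α : B, ι α * X = X * ι (ρ α) + ι (D α))
    (hfree : ∀ r : R, ∃! c : ℕ →₀ B, r = c.sum fun i b => X ^ i * ι b)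
    (m : ℕ) (hm : 1 ≤ m) (a : ℕ → B) (ham : a m = 1)
    (hρa : ∀ i ≤ m, ρ (a i) = a i)
    (f : R) (hf : f = ∑ i ∈ Finset.range (m + 1), X ^ i * ι (a i))
    (htwo : (Set.range fun r => f * r) = Set.range fun r => r * f)
    (π : R →+* A) (hπ : Function.Surjective π)
    (hker : ∀ r : R, π r = 0 ↔ ∃ s, r = f * s)
    (y : ℕ → A)
    (hy : ∀ j, y j = ∑ k ∈ Finset.Icc j (m - 1), π X ^ (k - j) * π (ι (a (k + 1))))
    (τ : A → A)
    (hτ : ∀ z, τ z = ∑ j ∈ Finset.range m, y j * z * π X ^ j)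
    (u : A)
    (hu1 : ∀ α : B, π (ι α) * u = u * π (ι (ρ α)))
    (hu2 : τ u = 0) :
    ∃ δ : A → A, (∀ z w : A, δ (z + w) = δ z + δ w) ∧
      (∀ z w : A, δ (z * w) = δ z * w + z * δ w) ∧
      (∀ β : B, δ (π (ι β)) = 0) ∧ δ (π X) = u := by
  have hD1 : D 1 = 0 := by simpa using hD 1 1
  have hfr : ∀ r, ∃ s, r * f = f * s := fun r => by
    obtain ⟨s, hs⟩ := htwo.symm.subset ⟨r, rfl⟩
    exact ⟨s, hs.symm⟩
  have hDa : ∀ i ≤ m, D (a i) = 0 := fun i hi =>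
    derivation_coeff_eq_zero hD1 hcomm hfree ham hρa hf (hfr X) hi
  have hax : ∀ i ≤ m, ∀ j, π (ι (a i)) * u * π X ^ j = u * π X ^ j * π (ι (a i)) :=
    fun i hi j => by
      have hc : Commute (ι (a i)) X := by
        simpa [hρa i hi, hDa i hi, commute_iff_eq] using hcomm (a i)
      have hcj : Commute (π (ι (a i))) (π X ^ j) := (hc.map π).pow_right j
      rw [hu1, hρa i hi, mul_assoc, hcj.eq, mul_assoc]
  obtain ⟨Δ, hmul, hΔ⟩ := exists_skew_derivation hcomm hfree π u hu1
  have hΔf : Δ f = 0 := by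
    rw [← hu2, hτ, hf, map_sum, Finset.sum_range_succ', hΔ]
    simp only [Finset.sum_range_zero, zero_mul, add_zero, hΔ, hy, Finset.sum_mul,
      Nat.add_sub_cancel]
    rw [Finset.sum_comm' (t' := Finset.range m) (s' := fun j => Finset.Icc j (m - 1))
      (by intro k j; simp only [Finset.mem_range, Finset.mem_Icc]; lia)]
    refine Finset.sum_congr rfl fun j _ => Finset.sum_congr rfl fun k hk => ?_
    have hk' : k + 1 ≤ m := by have := (Finset.mem_Icc.1 hk).2; lia
    rw [mul_assoc _ u, mul_assoc, ← hax (k + 1) hk' j]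
    simp only [mul_assoc]
  have hπf : π f = 0 := (hker f).2 ⟨1, (mul_one f).symm⟩
  have hle : ∀ r, π r = 0 → Δ r = 0 := fun r hr => by
    obtain ⟨s, rfl⟩ := (hker r).1 hr
    rw [hmul, hΔf, hπf, zero_mul, zero_mul, add_zero]
  have hΔπ : ∀ r, Δ (Function.surjInv hπ (π r)) = Δ r := fun r => by
    rw [← sub_eq_zero, ← map_sub]
    apply hle
    rw [map_sub, Function.surjInv_eq hπ, sub_self]
  refine ⟨fun z => Δ (Function.surjInv hπ z), fun z w => ?_, fun z w => ?_, fun β => ?_, ?_⟩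
  · obtain ⟨r, rfl⟩ := hπ z
    obtain ⟨s, rfl⟩ := hπ w
    rw [← map_add]
    simp only [hΔπ, map_add Δ]
  · obtain ⟨r, rfl⟩ := hπ z
    obtain ⟨s, rfl⟩ := hπ w
    rw [← map_mul]
    simp only [hΔπ, hmul]
  · simpa [hΔπ] using hΔ 0 β
  · simpa [hΔπ] using hΔ 1 1
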